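/- Let E ⊆ ℕA be the exponent set of a monomial ideal and let (a,F) be a standard pair of E. Then a is minimal with respect to divisibility in the set (a + ℝF) ∩ ℕA: if a' ∈ ℕA satisfies a − a' ∈ ℝF (i.e., a' ∈ a + ℝF) and a' divides a (i.e., a − a' ∈ ℕA), then a' = a. -/

import Mathlib

open scoped BigOperators

namespace StdPairsPaper

/-- The coercion of a lattice point to a real vector. -/
def toR {d : ℕ} (v : Fin d → ℤ) : Fin d → ℝ := fun i => (v i : ℝ)

/-- The cone of nonnegative real combinations of (the real images of) elements of `S`. -/
def cone {d : ℕ} (S : Set (Fin d → ℤ)) : Set (Fin d → ℝ) :=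
  {x | ∃ (t : Finset (Fin d → ℤ)) (c : (Fin d → ℤ) → ℝ),
    (t : Set (Fin d → ℤ)) ⊆ S ∧ (∀ v, 0 ≤ c v) ∧ x = ∑ v ∈ t, c v • toR v}

/-- `ℕS`, the submonoid of `ℤ^d` generated by `S`. -/
def NSemi {d : ℕ} (S : Set (Fin d → ℤ)) : AddSubmonoid (Fin d → ℤ) :=
  AddSubmonoid.closure S

/-- `ℤS`, the subgroup of `ℤ^d` generated by `S`. -/
def ZGrp {d : ℕ} (S : Set (Fin d → ℤ)) : AddSubgroup (Fin d → ℤ) :=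
  AddSubgroup.closure S

/-- `ℝS`, the real linear span of `S`. -/
def RSpan {d : ℕ} (S : Set (Fin d → ℤ)) : Submodule ℝ (Fin d → ℝ) :=
  Submodule.span ℝ (toR '' S)

/-- `A` is a configuration: a finite set of nonzero lattice points whose `ℤ`-span is `ℤ^d`
and whose nonnegative real cone is strongly convex (contains no line, i.e. is pointed). -/
structure IsConfig {d : ℕ} (A : Set (Fin d → ℤ)) : Prop where
  (finite : A.Finite)
  (nonzero : (0 : Fin d → ℤ) ∉ A)
  (spans : ZGrp A = ⊤)
  (pointed : ∀ x ∈ cone A, -x ∈ cone A → x = 0)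

/-- `F` is a face of the configuration `A`: `F ⊆ A`, the cone over `F` is an extreme
subset (face) of the cone over `A`, and `ℝ_{≥0}F ∩ A = F`. -/
def IsFace {d : ℕ} (A F : Set (Fin d → ℤ)) : Prop :=
  F ⊆ A ∧ IsExtreme ℝ (cone A) (cone F) ∧ cone F ∩ (toR '' A) = toR '' F

/-- The set `a + ℕF`. -/
def cell {d : ℕ} (a : Fin d → ℤ) (F : Set (Fin d → ℤ)) : Set (Fin d → ℤ) :=
  {x | ∃ f ∈ NSemi F, x = a + f}

/-- Two pairs `(a,F)` and `(b,F)` belonging to the same face `F` overlap: `a - b ∈ ℤF`. -/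
def Overlap {d : ℕ} (F : Set (Fin d → ℤ)) (a b : Fin d → ℤ) : Prop :=
  a - b ∈ ZGrp F

/-- The pair `(a,F)` divides the pair `(b,G)`:
there is `c ∈ ℕA` with `a + c + ℕF ⊆ b + ℕG`. -/
def PairDvd {d : ℕ} (A : Set (Fin d → ℤ)) (a : Fin d → ℤ) (F : Set (Fin d → ℤ))
    (b : Fin d → ℤ) (G : Set (Fin d → ℤ)) : Prop :=
  ∃ c ∈ NSemi A, cell (a + c) F ⊆ cell b G

/-- `E` is the exponent set of a monomial ideal of `ℕA`: `E ⊆ ℕA` and `E + ℕA ⊆ E`. -/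
def IsExpSet {d : ℕ} (A E : Set (Fin d → ℤ)) : Prop :=
  E ⊆ (NSemi A : Set (Fin d → ℤ)) ∧ ∀ e ∈ E, ∀ c ∈ NSemi A, e + c ∈ E

/-- The standard monomials of `E`: `ℕA ∖ E`. -/
def stdSet {d : ℕ} (A E : Set (Fin d → ℤ)) : Set (Fin d → ℤ) :=
  (NSemi A : Set (Fin d → ℤ)) \ E

/-- `(a,F)` is a proper pair of `E`: a pair of `A` with `a + ℕF ⊆ std(E)`. -/
def ProperPair {d : ℕ} (A E : Set (Fin d → ℤ)) (a : Fin d → ℤ)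
    (F : Set (Fin d → ℤ)) : Prop :=
  a ∈ NSemi A ∧ IsFace A F ∧ cell a F ⊆ stdSet A E

/-- `(a,F)` is a standard pair of `E`: a proper pair of `E` maximal with respect to
the partial order `(a,F) ≼ (b,G) ↔ a + ℕF ⊆ b + ℕG`. -/
def StdPair {d : ℕ} (A E : Set (Fin d → ℤ)) (a : Fin d → ℤ)
    (F : Set (Fin d → ℤ)) : Prop :=
  ProperPair A E a F ∧
    ∀ b G, ProperPair A E b G → cell a F ⊆ cell b G → cell b G ⊆ cell a F

/-- The overlap class of the standard pair `(a,F)` of `E` is maximal with respect to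
divisibility among overlap classes of standard pairs of `E`. -/
def MaxClass {d : ℕ} (A E : Set (Fin d → ℤ)) (a : Fin d → ℤ)
    (F : Set (Fin d → ℤ)) : Prop :=
  ∀ b G, StdPair A E b G → PairDvd A a F b G → PairDvd A b G a F

noncomputable section

/-- The affine semigroup ring `k[ℕA]`. -/
abbrev SGRing {d : ℕ} (k : Type*) [Field k] (A : Set (Fin d → ℤ)) :=
  AddMonoidAlgebra k (NSemi A)

/-- The monomial `t^a` of `k[ℕA]`. -/
def mono {d : ℕ} (k : Type*) [Field k] (A : Set (Fin d → ℤ)) (a : (NSemi A)) :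
    SGRing k A :=
  AddMonoidAlgebra.single a 1

/-- `I` is a monomial ideal of `k[ℕA]`: an ideal generated by monomials. -/
def IsMonomialIdeal {d : ℕ} (k : Type*) [Field k] (A : Set (Fin d → ℤ))
    (I : Ideal (SGRing k A)) : Prop :=
  ∃ S : Set (NSemi A), I = Ideal.span ((fun a => mono k A a) '' S)

/-- The exponent set `E(I) = {a ∈ ℕA : t^a ∈ I}` of an ideal of `k[ℕA]`,
as a subset of `ℤ^d`. -/
def expSet {d : ℕ} (k : Type*) [Field k] (A : Set (Fin d → ℤ))
    (I : Ideal (SGRing k A)) : Set (Fin d → ℤ) :=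
  {x | ∃ h : x ∈ NSemi A, mono k A ⟨x, h⟩ ∈ I}

/-- The monomial prime ideal `p_F = ⟨t^a : a ∈ ℕA ∖ ℕF⟩` of `k[ℕA]`. -/
def primeF {d : ℕ} (k : Type*) [Field k] (A F : Set (Fin d → ℤ)) :
    Ideal (SGRing k A) :=
  Ideal.span {x | ∃ a : (NSemi A), (a : Fin d → ℤ) ∉ NSemi F ∧ x = mono k A a}

end


lemma toR_zero {d : ℕ} : toR (0 : Fin d → ℤ) = 0 := by
  ext i; simp [toR]

lemma toR_add {d : ℕ} (v w : Fin d → ℤ) : toR (v + w) = toR v + toR w := by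
  ext i; simp [toR]

lemma toR_neg {d : ℕ} (v : Fin d → ℤ) : toR (-v) = -toR v := by
  ext i; simp [toR]

lemma toR_injective {d : ℕ} : Function.Injective (toR (d := d)) := by
  intro v w h
  ext i
  have hi := congrFun h i
  simpa [toR] using hi

lemma zero_mem_cone {d : ℕ} (S : Set (Fin d → ℤ)) : (0 : Fin d → ℝ) ∈ cone S :=
  ⟨∅, 0, by simp, by simp, by simp⟩

lemma toR_mem_cone {d : ℕ} {S : Set (Fin d → ℤ)} {v : Fin d → ℤ} (hv : v ∈ S) :
    toR v ∈ cone S :=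
  ⟨{v}, 1, by simpa using hv, by simp, by simp⟩

lemma smul_mem_cone {d : ℕ} {S : Set (Fin d → ℤ)} {x : Fin d → ℝ} (hx : x ∈ cone S)
    {r : ℝ} (hr : 0 ≤ r) : r • x ∈ cone S := by
  obtain ⟨t, c, ht, hc, rfl⟩ := hx
  refine ⟨t, fun v => r * c v, ht, fun v => mul_nonneg hr (hc v), ?_⟩
  simp [Finset.smul_sum, smul_smul]

lemma add_mem_cone {d : ℕ} {S : Set (Fin d → ℤ)} {x y : Fin d → ℝ} (hx : x ∈ cone S)
    (hy : y ∈ cone S) : x + y ∈ cone S := by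
  classical
  obtain ⟨t, c, ht, hc, rfl⟩ := hx
  obtain ⟨u, e, hu, he, rfl⟩ := hy
  refine ⟨t ∪ u, fun v => (if v ∈ t then c v else 0) + (if v ∈ u then e v else 0), ?_, ?_, ?_⟩
  · simpa using ⟨ht, hu⟩
  · intro v
    have h₁ := hc v
    have h₂ := he v
    positivity
  · simp only [add_smul, Finset.sum_add_distrib, ite_smul, zero_smul, Finset.sum_ite_mem,
      Finset.union_inter_cancel_left, Finset.union_inter_cancel_right]

lemma cone_mono {d : ℕ} {S T : Set (Fin d → ℤ)} (h : S ⊆ T) : cone S ⊆ cone T :=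
  fun _ ⟨t, c, ht, hc, hx⟩ => ⟨t, c, ht.trans h, hc, hx⟩

lemma toR_mem_cone_of_mem_NSemi {d : ℕ} {S : Set (Fin d → ℤ)} {v : Fin d → ℤ}
    (hv : v ∈ NSemi S) : toR v ∈ cone S := by
  induction hv using AddSubmonoid.closure_induction with
  | mem x hx => exact toR_mem_cone hx
  | zero => rw [toR_zero]; exact zero_mem_cone S
  | add x y _ _ hx hy => rw [toR_add]; exact add_mem_cone hx hy

/-- Every element of the real span is a difference of two elements of the cone. -/
lemma exists_add_mem_cone_of_mem_RSpan {d : ℕ} {S : Set (Fin d → ℤ)} {x : Fin d → ℝ}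
    (hx : x ∈ RSpan S) : ∃ q ∈ cone S, x + q ∈ cone S := by
  induction hx using Submodule.span_induction with
  | mem x hx =>
    obtain ⟨v, hv, rfl⟩ := hx
    exact ⟨0, zero_mem_cone S, by simpa using toR_mem_cone hv⟩
  | zero => exact ⟨0, zero_mem_cone S, by simpa using zero_mem_cone S⟩
  | add x y _ _ hx hy =>
    obtain ⟨p, hp, hxp⟩ := hx
    obtain ⟨q, hq, hyq⟩ := hy
    refine ⟨p + q, add_mem_cone hp hq, ?_⟩
    rw [add_add_add_comm]
    exact add_mem_cone hxp hyq
  | smul r x _ hx =>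
    obtain ⟨q, hq, hxq⟩ := hx
    rcases le_total 0 r with hr | hr
    · refine ⟨r • q, smul_mem_cone hq hr, ?_⟩
      rw [← smul_add]
      exact smul_mem_cone hxq hr
    · refine ⟨(-r) • (x + q), smul_mem_cone hxq (neg_nonneg.2 hr), ?_⟩
      have h : r • x + (-r) • (x + q) = (-r) • q := by module
      rw [h]
      exact smul_mem_cone hq (neg_nonneg.2 hr)

/-- A face of a cone contains both summands of any sum it contains. -/
lemma IsFace.left_mem_cone_of_add_mem {d : ℕ} {A F : Set (Fin d → ℤ)} (hF : IsFace A F)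
    {x y : Fin d → ℝ} (hx : x ∈ cone A) (hy : y ∈ cone A) (hxy : x + y ∈ cone F) :
    x ∈ cone F := by
  have h2 : (0 : ℝ) ≤ 2 := by norm_num
  have h : (2 : ℝ) • x ∈ cone F := by
    refine hF.2.1.left_mem_of_mem_openSegment (smul_mem_cone hx h2) (smul_mem_cone hy h2) hxy
      ⟨1 / 2, 1 / 2, by norm_num, by norm_num, by norm_num, by module⟩
  have h' := smul_mem_cone h (r := 1 / 2) (by norm_num)
  rwa [smul_smul, one_div, inv_mul_cancel₀ two_ne_zero, one_smul] at h'

lemma IsFace.mem_NSemi_of_toR_mem_cone {d : ℕ} {A F : Set (Fin d → ℤ)} (hF : IsFace A F)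
    {v : Fin d → ℤ} (hv : v ∈ NSemi A) (hvF : toR v ∈ cone F) : v ∈ NSemi F := by
  induction hv using AddSubmonoid.closure_induction with
  | mem x hx =>
    have h : toR x ∈ toR '' F := hF.2.2 ▸ ⟨hvF, x, hx, rfl⟩
    exact AddSubmonoid.subset_closure (toR_injective.mem_set_image.1 h)
  | zero => exact zero_mem _
  | add x y hxA hyA hx hy =>
    have hx' := toR_mem_cone_of_mem_NSemi hxA
    have hy' := toR_mem_cone_of_mem_NSemi hyA
    rw [toR_add] at hvF
    refine add_mem (hx (hF.left_mem_cone_of_add_mem hx' hy' hvF)) (hy ?_)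
    exact hF.left_mem_cone_of_add_mem hy' hx' (add_comm (toR x) _ ▸ hvF)

/-- `ℕA ∩ ℝF = ℕF` for a face `F` of `A`. -/
lemma IsFace.mem_NSemi_of_toR_mem_RSpan {d : ℕ} {A F : Set (Fin d → ℤ)} (hF : IsFace A F)
    {v : Fin d → ℤ} (hv : v ∈ NSemi A) (hvF : toR v ∈ RSpan F) : v ∈ NSemi F := by
  obtain ⟨q, hq, hvq⟩ := exists_add_mem_cone_of_mem_RSpan hvF
  exact hF.mem_NSemi_of_toR_mem_cone hv
    (hF.left_mem_cone_of_add_mem (toR_mem_cone_of_mem_NSemi hv) (cone_mono hF.1 hq) hvq)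

lemma IsConfig.eq_zero_of_mem_of_neg_mem {d : ℕ} {A : Set (Fin d → ℤ)} (hA : IsConfig A)
    {v : Fin d → ℤ} (hv : v ∈ NSemi A) (hv' : -v ∈ NSemi A) : v = 0 := by
  refine toR_injective ?_
  rw [toR_zero]
  refine hA.pointed _ (toR_mem_cone_of_mem_NSemi hv) ?_
  rw [← toR_neg]
  exact toR_mem_cone_of_mem_NSemi hv'

/-- If `(a,F)` is a standard pair of `E`, then `a` is minimal with
respect to divisibility in `(a + ℝF) ∩ ℕA`: if `a' ∈ ℕA` with `a - a' ∈ ℝF` and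
`a' ∣ a` (i.e. `a - a' ∈ ℕA`), then `a' = a`. -/
theorem stdPair_base_minimal {d : ℕ} (A : Set (Fin d → ℤ)) (hA : IsConfig A)
    (E : Set (Fin d → ℤ)) (hE : IsExpSet A E)
    (a : Fin d → ℤ) (F : Set (Fin d → ℤ)) (hstd : StdPair A E a F)
    (a' : Fin d → ℤ) (ha' : a' ∈ NSemi A)
    (hR : toR (a - a') ∈ RSpan F) (hdvd : a - a' ∈ NSemi A) :
    a' = a := by
  obtain ⟨⟨-, hF, hcell⟩, hmax⟩ := hstd
  have hFA : NSemi F ≤ NSemi A := AddSubmonoid.closure_mono hF.1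
  have hg : a - a' ∈ NSemi F := hF.mem_NSemi_of_toR_mem_RSpan hdvd hR
  have hproper : ProperPair A E a' F := by
    refine ⟨ha', hF, ?_⟩
    rintro _ ⟨f, hf, rfl⟩
    refine ⟨add_mem ha' (hFA hf), fun hmem => (hcell ⟨f, hf, rfl⟩).2 ?_⟩
    have h := hE.2 _ hmem _ hdvd
    rwa [show a' + f + (a - a') = a + f by abel] at h
  have hsub : cell a F ⊆ cell a' F := by
    rintro _ ⟨f, hf, rfl⟩
    exact ⟨a - a' + f, add_mem hg hf, by abel⟩
  obtain ⟨f, hf, hfa⟩ := hmax a' F hproper hsub ⟨0, zero_mem _, (add_zero a').symm⟩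
  have hneg : -(a - a') ∈ NSemi A := by
    rw [show -(a - a') = f by rw [hfa]; abel]
    exact hFA hf
  exact (sub_eq_zero.1 (hA.eq_zero_of_mem_of_neg_mem hdvd hneg)).symm

end StdPairsPaper
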